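/- arXiv:2508.08044 — 4 statements merged into one kernel-verified Lean document; each statement's English description precedes it below -/
import Mathlib

section
/- Let A be a C*-algebra, x ∈ A, and λ ∈ ℂ with λ ≠ 1. If x x* = λ · (x* x), then x = 0. -/
/-- In a C*-algebra, if `x x* = λ (x* x)` with `λ ≠ 1`, then `x = 0`. -/
theorem eq_zero_of_mul_star_eq_smul_star_mul {A : Type*} [NormedRing A] [StarRing A]
    [CStarRing A] [NormedAlgebra ℂ A] [StarModule ℂ A] [CompleteSpace A]
    (x : A) (lam : ℂ) (hlam : lam ≠ 1) (h : x * star x = lam • (star x * x)) :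
    x = 0 := by
  by_contra hx
  have hP : star x * x ≠ 0 := fun h0 => hx ((CStarRing.star_mul_self_eq_zero_iff x).1 h0)
  have hnorm : ‖lam‖ = 1 := by
    have h1 := congrArg norm h
    rw [norm_smul, CStarRing.norm_self_mul_star, CStarRing.norm_star_mul_self] at h1
    have hpos : 0 < ‖x‖ * ‖x‖ := by positivity
    exact mul_right_cancel₀ hpos.ne' (by rw [one_mul, ← h1])
  have hconj : star lam = lam := by
    have h1 := congrArg star h
    simp only [star_smul, star_mul, star_star] at h1
    rw [h] at h1
    exact (smul_left_injective ℂ hP h1).symm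
  obtain ⟨r, rfl⟩ := Complex.conj_eq_iff_real.1 hconj
  rw [Complex.norm_real, Real.norm_eq_abs] at hnorm
  rcases (abs_eq zero_le_one).1 hnorm with rfl | rfl
  · exact hlam Complex.ofReal_one
  · rw [Complex.ofReal_neg, Complex.ofReal_one, neg_one_smul] at h
    let _ : CStarAlgebra A := {}
    let _ := CStarAlgebra.spectralOrder A
    have := CStarAlgebra.spectralOrderedRing A
    refine hP (le_antisymm ?_ (star_mul_self_nonneg x))
    exact neg_nonneg.1 (h ▸ mul_star_self_nonneg x)
end

section
/- The extreme points of the convex set S of spreadable Borel probability measures on 𝕋^ℤ (probability measures μ such that the pushforward of μ under x ↦ x ∘ h equals μ for every strictly increasing h : ℤ → ℤ) are exactly the i.i.d. product measures: μ is an extreme point of S if and only if μ = ν^{⊗ℤ} for some Borel probability measure ν on 𝕋. -/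
open MeasureTheory
open scoped ENNReal

noncomputable instance : MeasurableSpace Circle := borel Circle
instance : BorelSpace Circle := ⟨rfl⟩

/-- A Borel probability measure on `𝕋^ℤ` is spreadable if it is invariant under the
action `x ↦ x ∘ h` of every strictly increasing map `h : ℤ → ℤ`. -/
def Spreadable (μ : Measure (ℤ → Circle)) : Prop :=
  ∀ h : ℤ → ℤ, StrictMono h → Measure.map (fun x => x ∘ h) μ = μ

/-- `μ` is the i.i.d. product measure `ν^{⊗ℤ}` on `𝕋^ℤ`, characterized by its
finite-dimensional cylinder marginals. -/
def IsIIDProduct (μ : Measure (ℤ → Circle)) (ν : Measure Circle) : Prop :=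
  ∀ (s : Finset ℤ) (g : ℤ → Set Circle), (∀ i ∈ s, MeasurableSet (g i)) →
    μ {x | ∀ i ∈ s, x i ∈ g i} = ∏ i ∈ s, ν (g i)

open Filter Topology ProbabilityTheory

/-- A mean ergodic theorem for events: the Cesàro means of `μ (B ∩ T⁻ᵏ A)` converge to `ρ B`
for a measure `ρ` dominated by `μ`. -/
theorem exists_measure_tendsto_cesaro {α : Type*} [MeasurableSpace α] {μ : Measure α}
    [IsFiniteMeasure μ] {T : α → α} (hT : MeasurePreserving T μ μ) {A : Set α}
    (hA : MeasurableSet A) :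
    ∃ ρ : Measure α, ρ ≤ μ ∧ ∀ B, MeasurableSet B →
      Tendsto (fun n : ℕ => (n⁻¹ : ℝ) * ∑ k ∈ Finset.range n, μ.real (B ∩ T^[k] ⁻¹' A))
        atTop (𝓝 (ρ.real B)) := by
  let U : Lp ℝ 2 μ →L[ℝ] Lp ℝ 2 μ :=
    (Lp.compMeasurePreservingₗᵢ ℝ T hT).toContinuousLinearMap
  have hU : ‖U‖ ≤ 1 := LinearIsometry.norm_toContinuousLinearMap_le _
  let f : Lp ℝ 2 μ := indicatorConstLp 2 hA (measure_ne_top μ A) (1 : ℝ)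
  have hUf (k : ℕ) : U^[k] f = indicatorConstLp 2 (hA.preimage (hT.iterate k).measurable)
      (measure_ne_top μ _) (1 : ℝ) := by
    have : (U : Lp ℝ 2 μ → Lp ℝ 2 μ) = Lp.compMeasurePreserving T hT := rfl
    rw [this, Lp.compMeasurePreserving_iterate]
    rfl
  obtain ⟨h, hh⟩ : ∃ h : Lp ℝ 2 μ, Tendsto (birkhoffAverage ℝ U _root_.id · f) atTop (𝓝 h) :=
    ⟨_, U.tendsto_birkhoffAverage_orthogonalProjection hU f⟩
  have hint : Integrable h μ := (Lp.memLp h).integrable one_le_two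
  have hlim (B : Set α) (hB : MeasurableSet B) :
      Tendsto (fun n : ℕ => (n⁻¹ : ℝ) * ∑ k ∈ Finset.range n, μ.real (B ∩ T^[k] ⁻¹' A))
        atTop (𝓝 (∫ x in B, h x ∂μ)) := by
    have key := (Filter.Tendsto.inner (𝕜 := ℝ)
      (tendsto_const_nhds (x := indicatorConstLp 2 hB (measure_ne_top μ B) (1 : ℝ))) hh)
    rw [L2.inner_indicatorConstLp_one] at key
    refine key.congr fun n => ?_
    simp only [birkhoffAverage, birkhoffSum, inner_smul_right, inner_sum, id, hUf,
      L2.inner_indicatorConstLp_one]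
    congr 1
    refine Finset.sum_congr rfl fun k _ => ?_
    rw [setIntegral_indicatorConstLp hB]
    simp [Set.inter_comm]
  have hnn : 0 ≤ᵐ[μ] h := ae_nonneg_of_forall_setIntegral_nonneg hint fun B hB _ =>
    ge_of_tendsto' (hlim B hB) fun n => by positivity
  have hle : h ≤ᵐ[μ] fun _ => (1 : ℝ) := by
    refine ae_le_of_forall_setIntegral_le hint (integrable_const _) fun B hB _ => ?_
    refine le_of_tendsto' (hlim B hB) fun n => ?_
    have hsum : ∑ k ∈ Finset.range n, μ.real (B ∩ T^[k] ⁻¹' A) ≤ n * μ.real B := by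
      simpa using Finset.sum_le_card_nsmul (Finset.range n)
        (fun k => μ.real (B ∩ T^[k] ⁻¹' A)) (μ.real B)
        fun k _ => measureReal_mono Set.inter_subset_left
    rcases n.eq_zero_or_pos with rfl | hn
    · simp
    · rw [inv_mul_le_iff₀ (by positivity)]
      simpa using hsum
  refine ⟨μ.withDensity fun x => ENNReal.ofReal (h x), ?_, fun B hB => ?_⟩
  · calc μ.withDensity (fun x => ENNReal.ofReal (h x)) ≤ μ.withDensity 1 :=
          withDensity_mono (hle.mono fun x hx => by simpa using hx)
      _ = μ := withDensity_one
  · have : (μ.withDensity fun x => ENNReal.ofReal (h x)).real B = ∫ x in B, h x ∂μ := by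
      rw [Measure.real, withDensity_apply _ hB, ← ofReal_integral_eq_lintegral_ofReal
        hint.integrableOn (ae_restrict_of_ae hnn), ENNReal.toReal_ofReal
        (setIntegral_nonneg_of_ae hnn)]
    rw [this]
    exact hlim B hB

theorem tendsto_cesaro_of_eventually_eq {u : ℕ → ℝ} {c : ℝ} (h : ∀ᶠ k in atTop, u k = c) :
    Tendsto (fun n : ℕ => (n⁻¹ : ℝ) * ∑ k ∈ Finset.range n, u k) atTop (𝓝 c) :=
  (tendsto_const_nhds.congr' (h.mono fun _ hk => hk.symm)).cesaro

theorem exists_forall_mem_lt (s : Finset ℤ) : ∃ m : ℤ, ∀ i ∈ s, i < m := by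
  obtain ⟨M, hM⟩ := s.exists_le
  exact ⟨M + 1, fun i hi => Int.lt_add_one_of_le (hM i hi)⟩

theorem measurableSet_cylinder (s : Finset ℤ) {g : ℤ → Set Circle}
    (hg : ∀ i, MeasurableSet (g i)) : MeasurableSet ((s : Set ℤ).pi g) :=
  MeasurableSet.pi s.countable_toSet fun i _ => hg i

theorem measurableSet_coord_mem (m : ℤ) {A : Set Circle} (hA : MeasurableSet A) :
    MeasurableSet {x : ℤ → Circle | x m ∈ A} :=
  hA.preimage (measurable_pi_apply m)

theorem measurable_comp_right (h : ℤ → ℤ) :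
    Measurable fun x : ℤ → Circle => x ∘ h :=
  measurable_pi_lambda _ fun i => measurable_pi_apply (h i)

/-- Finite measures on `𝕋^ℤ` agreeing on cylinders are equal. -/
theorem measure_ext_of_cylinder {μ ν : Measure (ℤ → Circle)} [IsFiniteMeasure μ]
    (h : ∀ (s : Finset ℤ) (g : ℤ → Set Circle), (∀ i, MeasurableSet (g i)) →
      μ ((s : Set ℤ).pi g) = ν ((s : Set ℤ).pi g)) : μ = ν := by
  refine ext_of_generate_finite _ (generateFrom_squareCylinders (α := fun _ : ℤ => Circle)).symm
    (isPiSystem_squareCylinders (fun _ => MeasurableSpace.isPiSystem_measurableSet)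
      fun _ => MeasurableSet.univ (α := Circle)) ?_ ?_
  · rintro _ ⟨s, g, hg, rfl⟩
    exact h s g fun i => hg i (Set.mem_univ i)
  · simpa using h ∅ (fun _ => Set.univ) fun _ => MeasurableSet.univ

/-- In a spreadable law, a coordinate to the right of a cylinder may be moved further right. -/
theorem Spreadable.measure_inter_coord {μ : Measure (ℤ → Circle)} (hμ : Spreadable μ)
    {s : Finset ℤ} {g : ℤ → Set Circle} (hg : ∀ i, MeasurableSet (g i)) {A : Set Circle}
    (hA : MeasurableSet A) {m k : ℤ} (hs : ∀ i ∈ s, i < m) (hmk : m ≤ k) :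
    μ ((s : Set ℤ).pi g ∩ {x | x k ∈ A}) = μ ((s : Set ℤ).pi g ∩ {x | x m ∈ A}) := by
  let h : ℤ → ℤ := fun n => if n < m then n else n + (k - m)
  have hh : StrictMono h := by
    intro a b hab
    simp only [h]
    split_ifs <;> omega
  conv_rhs => rw [← hμ h hh]
  rw [Measure.map_apply (measurable_comp_right h)
    ((measurableSet_cylinder s hg).inter (measurableSet_coord_mem m hA))]
  congr 1
  ext x
  have hm : h m = k := by simp [h]
  have hi : ∀ i ∈ s, h i = i := fun i hi => by simp [h, hs i hi]
  simp only [Set.mem_inter_iff, Set.mem_pi, Set.mem_ofPred_eq, Set.mem_preimage,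
    Function.comp_apply, hm, Finset.mem_coe]
  refine and_congr_left fun _ => forall₂_congr fun i his => ?_
  rw [hi i his]

theorem IsIIDProduct.of_measure_inter_coord {μ : Measure (ℤ → Circle)} [IsProbabilityMeasure μ]
    {ν : Measure Circle}
    (h : ∀ (s : Finset ℤ) (g : ℤ → Set Circle) (A : Set Circle) (m : ℤ),
      (∀ i, MeasurableSet (g i)) → MeasurableSet A → (∀ i ∈ s, i < m) →
      μ ((s : Set ℤ).pi g ∩ {x | x m ∈ A}) = μ ((s : Set ℤ).pi g) * ν A) :
    IsIIDProduct μ ν := by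
  classical
  have key (s : Finset ℤ) : ∀ g : ℤ → Set Circle, (∀ i, MeasurableSet (g i)) →
      μ ((s : Set ℤ).pi g) = ∏ i ∈ s, ν (g i) := by
    induction s using Finset.induction_on_max with
    | empty => simp
    | insert a s has ih =>
      intro g hg
      rw [Finset.prod_insert fun ha => (has a ha).false, ← ih g hg, mul_comm,
        ← h s g (g a) a hg (hg a) has, Finset.coe_insert, Set.insert_pi, Set.inter_comm]
      rfl
  intro s g hg
  have hg' (i : ℤ) : MeasurableSet (if i ∈ s then g i else Set.univ) := by
    split_ifs with hi
    exacts [hg i hi, MeasurableSet.univ]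
  convert key s (fun i => if i ∈ s then g i else Set.univ) hg' using 1
  · congr 1
    ext x
    simp +contextual [Set.mem_pi]
  · exact Finset.prod_congr rfl fun i hi => by simp [hi]

theorem IsIIDProduct.eq {μ₁ μ₂ : Measure (ℤ → Circle)} [IsFiniteMeasure μ₁] {ν : Measure Circle}
    (h₁ : IsIIDProduct μ₁ ν) (h₂ : IsIIDProduct μ₂ ν) : μ₁ = μ₂ :=
  measure_ext_of_cylinder fun s g hg =>
    (h₁ s g fun i _ => hg i).trans (h₂ s g fun i _ => hg i).symm

/-- The measure obtained by conditioning a spreadable law on an event at a coordinate infinitely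
far to the right. -/
theorem Spreadable.exists_tail_measure {μ : Measure (ℤ → Circle)} [IsFiniteMeasure μ]
    (hμ : Spreadable μ) {A : Set Circle} (hA : MeasurableSet A) :
    ∃ ρ : Measure (ℤ → Circle), ρ ≤ μ ∧ Spreadable ρ ∧
      ∀ (s : Finset ℤ) (g : ℤ → Set Circle) (m : ℤ), (∀ i, MeasurableSet (g i)) →
        (∀ i ∈ s, i < m) → ρ ((s : Set ℤ).pi g) = μ ((s : Set ℤ).pi g ∩ {x | x m ∈ A}) := by
  let T : (ℤ → Circle) → ℤ → Circle := fun x => x ∘ (· + 1)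
  have hT : MeasurePreserving T μ μ :=
    ⟨measurable_comp_right _, hμ _ fun a b hab => by simpa using hab⟩
  have hTk (k : ℕ) : T^[k] ⁻¹' {x | x 0 ∈ A} = {x | x k ∈ A} := by
    have (k : ℕ) (x : ℤ → Circle) (i : ℤ) : T^[k] x i = x (i + k) := by
      induction k generalizing x with
      | zero => simp
      | succ k ih =>
        rw [Function.iterate_succ_apply, ih]
        simp [T, add_assoc]
    ext x
    simp [this]
  obtain ⟨ρ, hρμ, hρ⟩ := exists_measure_tendsto_cesaro hT (measurableSet_coord_mem 0 hA)
  have : IsFiniteMeasure ρ := isFiniteMeasure_of_le μ hρμ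
  have hcyl (s : Finset ℤ) (g : ℤ → Set Circle) (m : ℤ) (hg : ∀ i, MeasurableSet (g i))
      (hs : ∀ i ∈ s, i < m) :
      ρ ((s : Set ℤ).pi g) = μ ((s : Set ℤ).pi g ∩ {x | x m ∈ A}) := by
    rw [← measureReal_eq_measureReal_iff]
    refine tendsto_nhds_unique (hρ _ (measurableSet_cylinder s hg))
      (tendsto_cesaro_of_eventually_eq ?_)
    filter_upwards [eventually_ge_atTop m.toNat] with k hk
    rw [hTk, Measure.real, hμ.measure_inter_coord hg hA hs (Int.toNat_le.mp hk), Measure.real]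
  refine ⟨ρ, hρμ, fun h hh => ?_, hcyl⟩
  refine measure_ext_of_cylinder fun s g hg => ?_
  obtain ⟨m, hm⟩ := exists_forall_mem_lt s
  have hcomap : (fun x : ℤ → Circle => x ∘ h) ⁻¹' (s : Set ℤ).pi g =
      ((s.map ⟨h, hh.injective⟩ : Finset ℤ) : Set ℤ).pi (fun j => g (Function.invFun h j)) := by
    ext x
    simp [Set.mem_pi, Function.leftInverse_invFun hh.injective _]
  rw [Measure.map_apply (measurable_comp_right h) (measurableSet_cylinder s hg), hcomap,
    hcyl _ _ (h m) (fun j => hg _) (by simpa using fun i hi => hh (hm i hi)), ← hcomap,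
    hcyl s g m hg hm]
  conv_rhs => rw [← hμ h hh]
  rw [Measure.map_apply (measurable_comp_right h)
    ((measurableSet_cylinder s hg).inter (measurableSet_coord_mem m hA))]
  rfl

theorem Spreadable.smul {μ : Measure (ℤ → Circle)} (hμ : Spreadable μ) (c : ℝ≥0∞) :
    Spreadable (c • μ) := fun h hh => by rw [Measure.map_smul, hμ h hh]

theorem Spreadable.sub {μ ρ : Measure (ℤ → Circle)} [IsFiniteMeasure μ] (hμ : Spreadable μ)
    (hρ : Spreadable ρ) (h : ρ ≤ μ) : Spreadable (μ - ρ) := by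
  have : IsFiniteMeasure ρ := isFiniteMeasure_of_le μ h
  intro f hf
  ext B hB
  have hm := measurable_comp_right f
  rw [Measure.map_apply hm hB, Measure.sub_apply (hm hB) h, Measure.sub_apply hB h,
    ← Measure.map_apply hm hB, ← Measure.map_apply hm hB, hμ f hf, hρ f hf]

/-- An extreme spreadable law dominates only multiples of itself among spreadable measures. -/
theorem eq_smul_of_le_of_extreme {μ : Measure (ℤ → Circle)} [IsProbabilityMeasure μ]
    (hμ : Spreadable μ)
    (hext : ∀ ν₁ ν₂ : Measure (ℤ → Circle), IsProbabilityMeasure ν₁ → IsProbabilityMeasure ν₂ →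
      Spreadable ν₁ → Spreadable ν₂ → ∀ t : ℝ≥0∞, 0 < t → t < 1 →
      μ = t • ν₁ + (1 - t) • ν₂ → ν₁ = μ ∧ ν₂ = μ)
    {ρ : Measure (ℤ → Circle)} (hρ : Spreadable ρ) (hle : ρ ≤ μ) :
    ρ = ρ Set.univ • μ := by
  have : IsFiniteMeasure ρ := isFiniteMeasure_of_le μ hle
  have hadd : μ - ρ + ρ = μ := Measure.sub_add_cancel_of_le hle
  have hsub : (μ - ρ) Set.univ = 1 - ρ Set.univ := by
    rw [Measure.sub_apply MeasurableSet.univ hle, measure_univ]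
  set t := ρ Set.univ with ht
  have ht1 : t ≤ 1 := (hle Set.univ).trans_eq measure_univ
  have htop : t ≠ ∞ := measure_ne_top ρ _
  rcases eq_or_ne t 0 with h0 | h0
  · rw [h0, zero_smul, ← Measure.measure_univ_eq_zero, ← ht, h0]
  rcases ht1.eq_or_lt with h1 | h1
  · rw [h1, tsub_self, Measure.measure_univ_eq_zero] at hsub
    rw [h1, one_smul, ← hadd, hsub, zero_add]
  have h1' : 1 - t ≠ 0 := (tsub_pos_of_lt h1).ne'
  have h1top : 1 - t ≠ ∞ := ENNReal.sub_ne_top ENNReal.one_ne_top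
  have key := (hext (t⁻¹ • ρ) ((1 - t)⁻¹ • (μ - ρ))
    ⟨by simp [← ht, ENNReal.inv_mul_cancel h0 htop]⟩
    ⟨by simp [hsub, ENNReal.inv_mul_cancel h1' h1top]⟩
    (hρ.smul _) ((hμ.sub hρ hle).smul _) t (pos_iff_ne_zero.mpr h0) h1
    (by rw [smul_smul, smul_smul, ENNReal.mul_inv_cancel h0 htop,
      ENNReal.mul_inv_cancel h1' h1top, one_smul, one_smul, add_comm, hadd])).1
  rw [← key, smul_smul, ENNReal.mul_inv_cancel h0 htop, one_smul]

theorem IsIIDProduct.measure_coord {μ : Measure (ℤ → Circle)} {ν : Measure Circle}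
    (h : IsIIDProduct μ ν) {A : Set Circle} (hA : MeasurableSet A) (k : ℤ) :
    μ {x | x k ∈ A} = ν A := by
  simpa using h {k} (fun _ => A) fun _ _ => hA

/-- Empirical frequencies under an i.i.d. law converge almost surely. -/
theorem IsIIDProduct.ae_tendsto_frequency {μ : Measure (ℤ → Circle)} [IsProbabilityMeasure μ]
    {ν : Measure Circle} (h : IsIIDProduct μ ν) {A : Set Circle} (hA : MeasurableSet A) :
    ∀ᵐ x ∂μ, Tendsto (fun n : ℕ => (n⁻¹ : ℝ) *
      ∑ k ∈ Finset.range n, {x : ℤ → Circle | x k ∈ A}.indicator (fun _ => (1 : ℝ)) x)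
      atTop (𝓝 (ν.real A)) := by
  let f : Circle → ℝ := A.indicator fun _ => 1
  have hf : Measurable f := measurable_const.indicator hA
  let X : ℕ → (ℤ → Circle) → ℝ := fun k x => f (x k)
  have hX (k : ℕ) : Measurable (X k) := hf.comp (measurable_pi_apply _)
  have hcoord : iIndepFun (fun (k : ℤ) (x : ℤ → Circle) => x k) μ := by
    rw [iIndepFun_iff_measure_inter_preimage_eq_mul]
    intro s g hg
    have : ⋂ i ∈ s, (fun x : ℤ → Circle => x i) ⁻¹' g i = {x | ∀ i ∈ s, x i ∈ g i} := by
      ext x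
      simp
    rw [this, h s g hg]
    exact Finset.prod_congr rfl fun i hi => (h.measure_coord (hg i hi) i).symm
  have hlaw (k : ℤ) : μ.map (fun x => x k) = μ.map (fun x => x 0) := by
    ext B hB
    rw [Measure.map_apply (measurable_pi_apply k) hB, Measure.map_apply (measurable_pi_apply 0) hB]
    exact (h.measure_coord hB k).trans (h.measure_coord hB 0).symm
  have hident (k : ℕ) : IdentDistrib (X k) (X 0) μ μ :=
    (IdentDistrib.mk (measurable_pi_apply (k : ℤ)).aemeasurable
      (measurable_pi_apply ((0 : ℕ) : ℤ)).aemeasurable (hlaw k)).comp hf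
  have hX_eq (k : ℕ) : X k = {x : ℤ → Circle | x k ∈ A}.indicator fun _ => (1 : ℝ) := rfl
  have hint : Integrable (X 0) μ := by
    rw [hX_eq]
    exact (integrable_const _).indicator (measurableSet_coord_mem _ hA)
  have hmean : μ[X 0] = ν.real A := by
    rw [hX_eq, integral_indicator_const _ (measurableSet_coord_mem _ hA), Measure.real,
      h.measure_coord hA]
    simp [Measure.real]
  have hlln := strong_law_ae_real X hint (fun i j hij =>
    (hcoord.indepFun (i := (i : ℤ)) (j := j) (by simpa using hij)).comp hf hf) hident
  rw [hmean] at hlln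
  filter_upwards [hlln] with x hx
  refine hx.congr fun n => ?_
  rw [div_eq_inv_mul]
  rfl

/-- A spreadable law absolutely continuous with respect to an i.i.d. law equals it. -/
theorem Spreadable.eq_of_absolutelyContinuous {μ κ : Measure (ℤ → Circle)}
    [IsProbabilityMeasure μ] [IsProbabilityMeasure κ] {ν : Measure Circle}
    [IsProbabilityMeasure ν] (hμ : IsIIDProduct μ ν) (hκ : Spreadable κ) (hac : κ ≪ μ) :
    κ = μ := by
  refine IsIIDProduct.eq (.of_measure_inter_coord fun s g A m hg hA hs => ?_) hμ
  set C := (s : Set ℤ).pi g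
  rw [← ENNReal.toReal_eq_toReal_iff' (measure_ne_top _ _)
    (ENNReal.mul_ne_top (measure_ne_top _ _) (measure_ne_top _ _)), ENNReal.toReal_mul]
  have hconst : Tendsto (fun n : ℕ => (n⁻¹ : ℝ) *
      ∑ k ∈ Finset.range n, κ.real (C ∩ {x | x k ∈ A})) atTop
      (𝓝 (κ.real (C ∩ {x | x m ∈ A}))) := by
    refine tendsto_cesaro_of_eventually_eq ?_
    filter_upwards [eventually_ge_atTop m.toNat] with k hk
    rw [Measure.real, hκ.measure_inter_coord hg hA hs (Int.toNat_le.mp hk), Measure.real]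
  refine tendsto_nhds_unique hconst ?_
  let F : ℕ → (ℤ → Circle) → ℝ := fun n x => (n⁻¹ : ℝ) *
    ∑ k ∈ Finset.range n, {x : ℤ → Circle | x k ∈ A}.indicator (fun _ => (1 : ℝ)) x
  have hind (k : ℤ) :
      Measurable ({x : ℤ → Circle | x k ∈ A}.indicator fun _ => (1 : ℝ)) :=
    measurable_const.indicator (measurableSet_coord_mem k hA)
  have hF (n : ℕ) : Measurable (F n) :=
    (Finset.measurable_sum (Finset.range n) fun k _ => hind k).const_mul _
  have hbound (n : ℕ) (x : ℤ → Circle) : ‖F n x‖ ≤ 1 := by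
    have hnn : 0 ≤ ∑ k ∈ Finset.range n,
        {x : ℤ → Circle | x k ∈ A}.indicator (fun _ => (1 : ℝ)) x :=
      Finset.sum_nonneg fun k _ => Set.indicator_nonneg (fun _ _ => zero_le_one) x
    have hsum : ∑ k ∈ Finset.range n,
        {x : ℤ → Circle | x k ∈ A}.indicator (fun _ => (1 : ℝ)) x ≤ n := by
      simpa using Finset.sum_le_card_nsmul (Finset.range n)
        (fun k : ℕ => {x : ℤ → Circle | x k ∈ A}.indicator (fun _ => (1 : ℝ)) x) 1
        fun k _ => Set.indicator_le_self' (fun _ _ => zero_le_one) x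
    rw [Real.norm_of_nonneg (by positivity)]
    exact inv_mul_le_one_of_le₀ hsum (Nat.cast_nonneg n)
  have hlim : Tendsto (fun n => ∫ x in C, F n x ∂κ) atTop (𝓝 (∫ _ in C, ν.real A ∂κ)) :=
    tendsto_integral_of_dominated_convergence (fun _ => 1)
      (fun n => (hF n).aestronglyMeasurable) (integrable_const _)
      (fun n => .of_forall (hbound n))
      (ae_restrict_of_ae (hac.ae_le (hμ.ae_tendsto_frequency hA)))
  rw [setIntegral_const, smul_eq_mul] at hlim
  refine hlim.congr fun n => ?_
  simp only [F]
  rw [integral_const_mul, integral_finsetSum (Finset.range n)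
    (f := fun (k : ℕ) => {x : ℤ → Circle | x k ∈ A}.indicator fun _ => (1 : ℝ)) fun k _ =>
    (integrable_const _).indicator (measurableSet_coord_mem k hA)]
  congr 1
  refine Finset.sum_congr rfl fun k _ => ?_
  rw [setIntegral_indicator (measurableSet_coord_mem k hA), setIntegral_const]
  simp

/-- de Finetti/Ryll-Nardzewski on `𝕋^ℤ`: a spreadable Borel probability measure on
`𝕋^ℤ` is an extreme point of the convex set of spreadable probability measures if and
only if it is an i.i.d. product measure `ν^{⊗ℤ}`. -/
theorem extreme_spreadable_iff_iid_product (μ : Measure (ℤ → Circle))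
    [IsProbabilityMeasure μ] (hμ : Spreadable μ) :
    (∀ ν₁ ν₂ : Measure (ℤ → Circle), IsProbabilityMeasure ν₁ → IsProbabilityMeasure ν₂ →
        Spreadable ν₁ → Spreadable ν₂ → ∀ t : ℝ≥0∞, 0 < t → t < 1 →
        μ = t • ν₁ + (1 - t) • ν₂ → ν₁ = μ ∧ ν₂ = μ) ↔
      ∃ ν : Measure Circle, IsProbabilityMeasure ν ∧ IsIIDProduct μ ν := by
  constructor
  · intro hext
    refine ⟨μ.map fun x => x 0, Measure.isProbabilityMeasure_map
      (measurable_pi_apply 0).aemeasurable, .of_measure_inter_coord fun s g A m hg hA hs => ?_⟩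
    obtain ⟨ρ, hle, hρ, hcyl⟩ := hμ.exists_tail_measure hA
    have huniv : ρ Set.univ = μ {x | x 0 ∈ A} := by
      simpa using hcyl ∅ (fun _ => Set.univ) 0 (fun _ => MeasurableSet.univ) (by simp)
    rw [← hcyl s g m hg hs, eq_smul_of_le_of_extreme hμ hext hρ hle, Measure.smul_apply,
      huniv, Measure.map_apply (measurable_pi_apply 0) hA, smul_eq_mul, mul_comm]
    rfl
  · rintro ⟨ν, _, hν⟩ ν₁ ν₂ _ _ h₁ h₂ t ht0 ht1 rfl
    constructor
    · refine h₁.eq_of_absolutelyContinuous hν ?_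
      exact (Measure.absolutelyContinuous_smul ht0.ne').trans
        (Measure.absolutelyContinuous_of_le (Measure.le_add_right le_rfl))
    · refine h₂.eq_of_absolutelyContinuous hν ?_
      exact (Measure.absolutelyContinuous_smul (tsub_pos_of_lt ht1).ne').trans
        (Measure.absolutelyContinuous_of_le (Measure.le_add_left le_rfl))
end

section
/- The set of ergodic shift-invariant Borel probability measures on 𝕋^ℤ is dense, with respect to the topology of weak convergence of probability measures, in the set of all shift-invariant Borel probability measures on 𝕋^ℤ. -/
open MeasureTheory
open scoped ENNReal

/-- The shift on `𝕋^ℤ`: `(τ x)(l) = x(l+1)`. -/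
def circleShift : (ℤ → Circle) → (ℤ → Circle) := fun x l => x (l + 1)

open Filter Topology Finset ProbabilityTheory

section Dynamics

variable {X : Type*} [MeasurableSpace X]

/-- The uniform probability measure on the first `P` points of the orbit of `y` under `T`,
counted with multiplicity. -/
noncomputable def orbitMeasure (T : X → X) (y : X) (P : ℕ) : Measure X :=
  (P : ℝ≥0∞)⁻¹ • ∑ k ∈ range P, Measure.dirac (T^[k] y)

theorem isProbabilityMeasure_orbitMeasure (T : X → X) (y : X) {P : ℕ} (hP : P ≠ 0) :
    IsProbabilityMeasure (orbitMeasure T y P) := by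
  constructor
  simp [orbitMeasure, ENNReal.inv_mul_cancel, hP]

theorem map_orbitMeasure {T : X → X} (hT : Measurable T) {y : X} {P : ℕ}
    (hy : T^[P] y = y) : (orbitMeasure T y P).map T = orbitMeasure T y P := by
  have h : (∑ k ∈ range P, Measure.dirac (T^[k + 1] y)) + Measure.dirac (T^[0] y) =
      (∑ k ∈ range P, Measure.dirac (T^[k] y)) + Measure.dirac (T^[0] y) := by
    rw [← sum_range_succ' (fun k => Measure.dirac (T^[k] y)), sum_range_succ, hy,
      Function.iterate_zero, id]
  rw [orbitMeasure, Measure.map_smul]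
  congr 1
  rw [← Measure.mapₗ_apply_of_measurable hT, map_sum]
  simp only [Measure.mapₗ_apply_of_measurable hT, Measure.map_dirac' hT]
  ext s hs
  have h' := congrArg (fun ν : Measure X => ν s) h
  simp only [Measure.add_apply, Function.iterate_succ_apply'] at h'
  exact (ENNReal.add_left_inj (measure_ne_top _ _)).1 h'

theorem ergodic_orbitMeasure {T : X → X} (hT : Measurable T) {y : X} {P : ℕ}
    (hy : T^[P] y = y) : Ergodic T (orbitMeasure T y P) where
  measurable := hT
  map_eq := map_orbitMeasure hT hy
  aeconst_set s hs hinv := by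
    have hmem : ∀ k : ℕ, T^[k] y ∈ s ↔ y ∈ s := by
      intro k
      induction k with
      | zero => rfl
      | succ k ih => rw [Function.iterate_succ_apply', ← ih, ← Set.mem_preimage, hinv]
    rw [eventuallyConst_set]
    by_cases h : y ∈ s
    · left
      change orbitMeasure T y P sᶜ = 0
      simp [orbitMeasure, Measure.dirac_apply' _ hs.compl, hmem, h]
    · right
      change orbitMeasure T y P {x | ¬ x ∉ s} = 0
      simp [orbitMeasure, Measure.dirac_apply' _ hs, hmem, h]

theorem integral_orbitMeasure {E : Type*} [NormedAddCommGroup E] [NormedSpace ℝ E]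
    [CompleteSpace E] (T : X → X) (y : X) (P : ℕ) {f : X → E} (hf : StronglyMeasurable f) :
    ∫ x, f x ∂(orbitMeasure T y P) = (P : ℝ)⁻¹ • ∑ k ∈ range P, f (T^[k] y) := by
  rw [orbitMeasure, integral_smul_measure, integral_finsetSum_measure]
  · simp [integral_dirac' _ _ hf]
  · intro i _
    exact (integrable_dirac' hf (by simp))

/-- Finite samples whose averages approximate the expectation of a vector-valued function. -/
theorem exists_sample_average_close {E : Type*} [NormedAddCommGroup E] [NormedSpace ℝ E]
    [CompleteSpace E] [MeasurableSpace E] [BorelSpace E] (μ : Measure X)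
    [IsProbabilityMeasure μ] {f : X → E} (hf : Measurable f) (hint : Integrable f μ)
    {ε : ℝ} (hε : 0 < ε) :
    ∃ K : ℕ, 0 < K ∧ ∃ x : ℕ → X,
      ‖(K : ℝ)⁻¹ • ∑ i ∈ range K, f (x i) - ∫ x, f x ∂μ‖ < ε := by
  have hmp (i : ℕ) := measurePreserving_eval_infinitePi (fun _ : ℕ => μ) i
  have key := strong_law_ae (μ := Measure.infinitePi fun _ : ℕ => μ)
    (fun i (ω : ℕ → X) => f (ω i))
    ((hmp 0).integrable_comp_of_integrable hint)
    (fun i j hij => (iIndepFun_infinitePi (X := fun _ => f) (fun _ => hf)).indepFun hij)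
    (fun i => ⟨(hf.comp (hmp i).measurable).aemeasurable,
      (hf.comp (hmp 0).measurable).aemeasurable, by
      have h (j : ℕ) : Measure.map (fun ω : ℕ → X => f (ω j))
          (Measure.infinitePi fun _ : ℕ => μ) = μ.map f := by
        conv_rhs => rw [← (hmp j).map_eq, Measure.map_map hf (hmp j).measurable]
        rfl
      rw [h, h]⟩)
  obtain ⟨x, hx⟩ := key.exists
  have hE : ∫ ω, f (ω 0) ∂(Measure.infinitePi fun _ : ℕ => μ) = ∫ x, f x ∂μ := by
    have h := integral_map (hmp 0).measurable.aemeasurable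
      (f := f) (by rw [(hmp 0).map_eq]; exact hint.aestronglyMeasurable)
    rw [(hmp 0).map_eq] at h
    exact h.symm
  rw [hE] at hx
  obtain ⟨K, hK, hK0⟩ :=
    ((Metric.tendsto_nhds.1 hx ε hε).and (eventually_gt_atTop 0)).exists
  exact ⟨K, hK0, x, by rwa [dist_eq_norm] at hK⟩

end Dynamics

/-- A continuous function on a compact product depends, up to `ε`, on finitely many
coordinates. -/
theorem exists_finset_dist_lt_of_eqOn {ι A E : Type*} [UniformSpace A] [CompactSpace A]
    [PseudoMetricSpace E] {f : (ι → A) → E} (hf : Continuous f) {ε : ℝ} (hε : 0 < ε) :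
    ∃ I : Finset ι, ∀ x x' : ι → A, (∀ i ∈ I, x i = x' i) → dist (f x) (f x') < ε := by
  have h := (CompactSpace.uniformContinuous_of_continuous hf) (Metric.dist_mem_uniformity hε)
  rw [Filter.mem_map, Pi.uniformity, mem_iInf'] at h
  obtain ⟨I, hI, V, hV, -, hU, -⟩ := h
  refine ⟨hI.toFinset, fun x x' hxx' => ?_⟩
  have hmem : (x, x') ∈ ⋂ i ∈ I, V i := by
    refine Set.mem_iInter₂.2 fun i hi => ?_
    obtain ⟨t, ht, htV⟩ := hV i
    refine htV ?_
    change (x i, x' i) ∈ t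
    rw [hxx' i (hI.mem_toFinset.2 hi)]
    exact refl_mem_uniformity ht
  rw [← hU] at hmem
  exact hmem

theorem sum_range_mul_eq_sum_sum {M : Type*} [AddCommMonoid M] (g : ℕ → M) (N K : ℕ) :
    ∑ k ∈ range (N * K), g k = ∑ i ∈ range K, ∑ j ∈ range N, g (N * i + j) := by
  induction K with
  | zero => simp
  | succ K ih => rw [Nat.mul_succ, sum_range_add, ih, sum_range_succ]

theorem continuous_circleShift : Continuous circleShift :=
  continuous_pi fun l => continuous_apply (l + 1)

theorem circleShift_iterate_apply (k : ℕ) (x : ℤ → Circle) (l : ℤ) :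
    circleShift^[k] x l = x (l + k) := by
  induction k generalizing l with
  | zero => simp
  | succ k ih =>
    rw [Function.iterate_succ_apply']
    change circleShift^[k] x (l + 1) = _
    rw [ih]
    congr 1
    push_cast
    ring

/-- The periodic sequence obtained by repeating the concatenation of the restrictions of
`x 0, …, x (K - 1)` to `[0, N)`. -/
def concatPeriodic (N K : ℕ) (x : ℕ → ℤ → Circle) : ℤ → Circle :=
  fun l => x ((l % (N * K : ℕ)) / N).toNat (l % N)

theorem circleShift_iterate_concatPeriodic (N K : ℕ) (x : ℕ → ℤ → Circle) :
    circleShift^[N * K] (concatPeriodic N K x) = concatPeriodic N K x := by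
  funext l
  rw [circleShift_iterate_apply]
  unfold concatPeriodic
  rw [Int.add_emod_right]
  congr 1
  push_cast
  rw [Int.add_mul_emod_self_left]

theorem concatPeriodic_apply {N K : ℕ} (x : ℕ → ℤ → Circle) {i j : ℕ} (hi : i < K)
    (hj : j < N) : concatPeriodic N K x (N * i + j : ℕ) = x i j := by
  have h1 : N * i + j < N * K := by nlinarith
  unfold concatPeriodic
  rw [← Int.natCast_mod, ← Int.natCast_mod, ← Int.natCast_div, Nat.mod_eq_of_lt h1,
    Int.toNat_natCast, Nat.mul_add_mod, Nat.mod_eq_of_lt hj,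
    Nat.mul_add_div (by omega), Nat.div_eq_of_lt hj, add_zero]

section Blocks

variable {E : Type*} [NormedAddCommGroup E]

theorem norm_sum_block_sub_le {f : (ℤ → Circle) → E} {C ε : ℝ} (hC : ∀ x, ‖f x‖ ≤ C)
    (hε : 0 ≤ ε) {m : ℕ}
    (hm : ∀ x x' : ℤ → Circle, (∀ l : ℤ, l.natAbs ≤ m → x l = x' l) → dist (f x) (f x') ≤ ε)
    {N K : ℕ} (x : ℕ → ℤ → Circle) {i : ℕ} (hi : i < K) :
    ‖∑ j ∈ range N, (f (circleShift^[N * i + j] (concatPeriodic N K x)) -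
      f (circleShift^[j] (x i)))‖ ≤ N * ε + 4 * m * C := by
  have hC0 : 0 ≤ C := (norm_nonneg _).trans (hC 1)
  have hterm : ∀ j ∈ range N, ‖f (circleShift^[N * i + j] (concatPeriodic N K x)) -
      f (circleShift^[j] (x i))‖ ≤ ε + if j < m ∨ N ≤ j + m then 2 * C else 0 := by
    intro j _
    split_ifs with hjm
    · have h := (norm_sub_le (f (circleShift^[N * i + j] (concatPeriodic N K x)))
        (f (circleShift^[j] (x i)))).trans (add_le_add (hC _) (hC _))
      linarith
    · rw [add_zero, ← dist_eq_norm]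
      refine hm _ _ fun l hl => ?_
      rw [circleShift_iterate_apply, circleShift_iterate_apply]
      obtain ⟨n, hn⟩ := Int.eq_ofNat_of_zero_le (show 0 ≤ l + j by omega)
      have hnN : n < N := by omega
      rw [hn, ← concatPeriodic_apply x hi hnN]
      congr 1
      push_cast
      linarith
  refine (norm_sum_le_of_le _ hterm).trans ?_
  rw [sum_add_distrib, sum_const, card_range, nsmul_eq_mul, ← sum_filter, sum_const,
    nsmul_eq_mul]
  have hcard : #{j ∈ range N | j < m ∨ N ≤ j + m} ≤ 2 * m := by
    have hsub : {j ∈ range N | j < m ∨ N ≤ j + m} ⊆ range m ∪ Ico (N - m) N := by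
      intro j
      simp only [mem_filter, mem_range, mem_union, mem_Ico]
      omega
    refine (card_le_card hsub).trans ((card_union_le _ _).trans ?_)
    rw [card_range, Nat.card_Ico]
    omega
  have hcard' : (#{j ∈ range N | j < m ∨ N ≤ j + m} : ℝ) ≤ 2 * m := by exact_mod_cast hcard
  nlinarith

variable [NormedSpace ℝ E]

theorem norm_average_concatPeriodic_sub_le {f : (ℤ → Circle) → E} {C ε : ℝ}
    (hC : ∀ x, ‖f x‖ ≤ C) (hε : 0 ≤ ε) {m : ℕ}
    (hm : ∀ x x' : ℤ → Circle, (∀ l : ℤ, l.natAbs ≤ m → x l = x' l) → dist (f x) (f x') ≤ ε)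
    {N K : ℕ} (hN : 0 < N) (hK : 0 < K) (x : ℕ → ℤ → Circle) :
    ‖((N * K : ℕ) : ℝ)⁻¹ • ∑ k ∈ range (N * K), f (circleShift^[k] (concatPeriodic N K x)) -
      (K : ℝ)⁻¹ • ∑ i ∈ range K, (N : ℝ)⁻¹ • ∑ j ∈ range N, f (circleShift^[j] (x i))‖ ≤
      ε + 4 * m * C / N := by
  have hN' : (0 : ℝ) < N := by exact_mod_cast hN
  have hK' : (0 : ℝ) < K := by exact_mod_cast hK
  rw [sum_range_mul_eq_sum_sum, ← smul_sum, smul_smul, Nat.cast_mul, mul_comm (N : ℝ),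
    mul_inv, ← smul_sub, ← sum_sub_distrib, norm_smul]
  simp only [← sum_sub_distrib]
  have h := norm_sum_le_of_le (range K) fun i hi =>
    norm_sum_block_sub_le (N := N) hC hε hm x (mem_range.1 hi)
  rw [sum_const, card_range, nsmul_eq_mul] at h
  rw [norm_mul, norm_inv, norm_inv, Real.norm_natCast, Real.norm_natCast]
  refine (mul_le_mul_of_nonneg_left h (by positivity)).trans (le_of_eq ?_)
  field_simp

/-- Averages of a continuous function over periodic orbits approximate its integral against
any shift-invariant probability measure. -/
theorem exists_periodic_average_close [CompleteSpace E] [MeasurableSpace E] [BorelSpace E]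
    (μ : Measure (ℤ → Circle)) [IsProbabilityMeasure μ]
    (hμ : MeasurePreserving circleShift μ μ) {f : (ℤ → Circle) → E} (hf : Continuous f)
    (hfi : Integrable f μ) {ε : ℝ} (hε : 0 < ε) :
    ∃ (P : ℕ) (y : ℤ → Circle), P ≠ 0 ∧ circleShift^[P] y = y ∧
      ‖(P : ℝ)⁻¹ • ∑ k ∈ range P, f (circleShift^[k] y) - ∫ x, f x ∂μ‖ < ε := by
  obtain ⟨C, hC⟩ : ∃ C, ∀ x, ‖f x‖ ≤ C := by
    obtain ⟨C, hC⟩ := isCompact_univ.exists_bound_of_continuousOn hf.continuousOn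
    exact ⟨C, fun x => hC x trivial⟩
  obtain ⟨I, hI⟩ := exists_finset_dist_lt_of_eqOn hf (show 0 < ε / 3 by positivity)
  set m := I.sup Int.natAbs
  have hm : ∀ x x' : ℤ → Circle, (∀ l : ℤ, l.natAbs ≤ m → x l = x' l) →
      dist (f x) (f x') ≤ ε / 3 :=
    fun x x' h => (hI x x' fun l hl => h l (le_sup (f := Int.natAbs) hl)).le
  obtain ⟨N, hN0, hN⟩ : ∃ N : ℕ, 0 < N ∧ 4 * m * C / N < ε / 3 := by
    have h := tendsto_const_div_atTop_nhds_zero_nat (4 * m * C)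
    exact ((eventually_gt_atTop 0).and
      (h.eventually_lt_const (show 0 < ε / 3 by positivity))).exists
  set g : (ℤ → Circle) → E :=
    fun x => (N : ℝ)⁻¹ • ∑ j ∈ range N, f (circleShift^[j] x) with hg
  have hgc : Continuous g :=
    (continuous_finsetSum _ fun j _ =>
      hf.comp (continuous_circleShift.iterate j)).const_smul _
  have hji (j : ℕ) : Integrable (fun x => f (circleShift^[j] x)) μ :=
    (hμ.iterate j).integrable_comp_of_integrable hfi
  have hgi : Integrable g μ := (integrable_finsetSum _ fun j _ => hji j).smul _
  have hgf : ∫ x, g x ∂μ = ∫ x, f x ∂μ := by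
    have hj (j : ℕ) : ∫ x, f (circleShift^[j] x) ∂μ = ∫ x, f x ∂μ := by
      have h := integral_map (hμ.iterate j).measurable.aemeasurable
        (f := f) (by rw [(hμ.iterate j).map_eq]; exact hfi.aestronglyMeasurable)
      rw [(hμ.iterate j).map_eq] at h
      exact h.symm
    rw [hg, integral_smul, integral_finsetSum _ fun j _ => hji j]
    simp only [hj, sum_const, card_range]
    rw [← Nat.cast_smul_eq_nsmul ℝ, smul_smul, inv_mul_cancel₀ (by positivity), one_smul]
  obtain ⟨K, hK0, x, hx⟩ :=
    exists_sample_average_close μ hgc.measurable hgi (show 0 < ε / 3 by positivity)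
  refine ⟨N * K, concatPeriodic N K x, (Nat.mul_pos hN0 hK0).ne',
    circleShift_iterate_concatPeriodic N K x, ?_⟩
  have h := norm_average_concatPeriodic_sub_le hC (show 0 ≤ ε / 3 by positivity) hm hN0 hK0 x
  rw [hgf] at hx
  refine (norm_sub_le_norm_sub_add_norm_sub _ _ _).trans_lt
    ((add_lt_add_of_le_of_lt h hx).trans ?_)
  linarith

end Blocks

/-- A criterion for membership in a closure in the topology of weak convergence. -/
theorem mem_closure_of_forall_finset_integral {X : Type*} [TopologicalSpace X]
    [MeasurableSpace X] [OpensMeasurableSpace X] {μ : ProbabilityMeasure X}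
    {s : Set (ProbabilityMeasure X)}
    (h : ∀ (S : Finset (BoundedContinuousFunction X ℝ)) (ε : ℝ), 0 < ε →
      ∃ η ∈ s, ∀ f ∈ S, |∫ x, f x ∂(η : Measure X) - ∫ x, f x ∂(μ : Measure X)| < ε) :
    μ ∈ closure s := by
  classical
  choose η hηs hη using fun p : Finset (BoundedContinuousFunction X ℝ) × ℕ =>
    h p.1 (1 / ((p.2 : ℝ) + 1)) (by positivity)
  refine mem_closure_of_tendsto (f := η) (b := atTop) ?_ (Eventually.of_forall hηs)
  rw [ProbabilityMeasure.tendsto_iff_forall_integral_tendsto]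
  intro f
  rw [Metric.tendsto_nhds]
  intro ε hε
  obtain ⟨n, hn⟩ := exists_nat_one_div_lt hε
  filter_upwards [eventually_ge_atTop (({f}, n) : Finset _ × ℕ)] with p hp
  rw [Real.dist_eq]
  refine (hη p f (hp.1 (mem_singleton_self f))).trans (lt_of_le_of_lt ?_ hn)
  exact one_div_le_one_div_of_le (by positivity) (by have : n ≤ p.2 := hp.2; gcongr)

/-- The ergodic shift-invariant Borel probability measures on `𝕋^ℤ` are dense, in the
topology of weak convergence, in the set of all shift-invariant Borel probability
measures on `𝕋^ℤ`. -/
theorem ergodic_dense_in_shiftInvariant (μ : ProbabilityMeasure (ℤ → Circle))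
    (hμ : Measure.map circleShift (μ : Measure (ℤ → Circle)) = (μ : Measure (ℤ → Circle))) :
    μ ∈ closure {η : ProbabilityMeasure (ℤ → Circle) |
      Measure.map circleShift (η : Measure (ℤ → Circle)) = (η : Measure (ℤ → Circle)) ∧
      Ergodic circleShift (η : Measure (ℤ → Circle))} := by
  have hT : Measurable circleShift := continuous_circleShift.measurable
  refine mem_closure_of_forall_finset_integral fun S ε hε => ?_
  have hfi (f : S) : Integrable (fun x => f.1 x) (μ : Measure (ℤ → Circle)) :=
    f.1.integrable _
  obtain ⟨P, y, hP, hy, hclose⟩ := exists_periodic_average_close (E := S → ℝ)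
    (μ : Measure (ℤ → Circle)) ⟨hT, hμ⟩ (f := fun x f => f.1 x)
    (continuous_pi fun f => f.1.continuous) (Integrable.of_eval hfi) hε
  refine ⟨⟨orbitMeasure circleShift y P, isProbabilityMeasure_orbitMeasure _ y hP⟩,
    ⟨map_orbitMeasure hT hy, ergodic_orbitMeasure hT hy⟩, fun f hf => ?_⟩
  have h := (norm_le_pi_norm _ (⟨f, hf⟩ : S)).trans_lt hclose
  rw [Pi.sub_apply, eval_integral hfi, Pi.smul_apply, Finset.sum_apply, Real.norm_eq_abs] at h
  rw [ProbabilityMeasure.coe_mk, integral_orbitMeasure _ _ _ f.continuous.stronglyMeasurable]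
  exact h
end

section
/- Let X be a measurable space, T : X → X a measurable map, n ≥ 1 a natural number, and μ a probability measure on X which is invariant and ergodic for the n-th iterate Tⁿ. Then the averaged measure ν = (1/n) Σ_{k=0}^{n−1} (T^k)_*μ is invariant and ergodic for T. -/
open MeasureTheory
open scoped ENNReal

namespace MeasureTheory

variable {X : Type*} [MeasurableSpace X] {T : X → X} {n : ℕ} {μ : Measure X}

/-- The sum of the push-forwards of a `Tⁿ`-invariant measure along an orbit of length `n` is
`T`-invariant. -/
theorem MeasurePreserving.sum_map_iterate (hT : Measurable T)
    (hμ : MeasurePreserving T^[n] μ μ) :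
    MeasurePreserving T (∑ k ∈ Finset.range n, μ.map T^[k])
      (∑ k ∈ Finset.range n, μ.map T^[k]) := by
  refine ⟨hT, Measure.ext fun s hs ↦ ?_⟩
  have hstep (k : ℕ) : μ.map T^[k] (T ⁻¹' s) = μ.map T^[k + 1] s := by
    rw [Measure.map_apply (hT.iterate k) (hT hs), Measure.map_apply (hT.iterate (k + 1)) hs,
      Function.iterate_succ', Set.preimage_comp]
  rw [Measure.map_apply hT hs, Measure.finsetSum_apply, Measure.finsetSum_apply,
    Finset.sum_congr rfl fun k _ ↦ hstep k]
  cases n with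
  | zero => simp
  | succ m =>
    rw [Finset.sum_range_succ, Finset.sum_range_succ', hμ.map_eq, Function.iterate_zero,
      Measure.map_id]

/-- If `μ` is pre-ergodic for `T`, then so is any finite sum of push-forwards of `μ` under iterates
of `T`. -/
theorem _root_.PreErgodic.sum_map_iterate (hT : Measurable T) (hμ : PreErgodic T μ)
    (t : Finset ℕ) : PreErgodic T (∑ k ∈ t, μ.map T^[k]) where
  aeconst_set s hs hTs := by
    have hnull {u : Set X} (hu : MeasurableSet u) (hTu : T ⁻¹' u = u) (h : μ u = 0) :
        (∑ k ∈ t, μ.map T^[k]) u = 0 := by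
      rw [Measure.finsetSum_apply]
      refine Finset.sum_eq_zero fun k _ ↦ ?_
      have hk : T^[k] ⁻¹' u = u := Function.IsFixedPt.preimage_iterate hTu k
      rw [Measure.map_apply (hT.iterate k) hu, hk, h]
    rw [Filter.eventuallyConst_set', ae_eq_empty, ae_eq_univ]
    exact (hμ.measure_self_or_compl_eq_zero hs hTs).imp (hnull hs hTs)
      (hnull hs.compl (by rw [Set.preimage_compl, hTs]))

end MeasureTheory

/-- If a probability measure `μ` is invariant and ergodic for the `n`-th iterate `Tⁿ`
of a measurable map `T` (`n ≥ 1`), then the averaged measure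
`ν = (1/n) Σ_{k=0}^{n-1} (T^k)_* μ` is invariant and ergodic for `T`. -/
theorem average_of_ergodic_iterate {X : Type*} [MeasurableSpace X] (T : X → X)
    (hT : Measurable T) (n : ℕ) (hn : 1 ≤ n) (μ : Measure X) [IsProbabilityMeasure μ]
    (hμ : Ergodic (T^[n]) μ) :
    MeasurePreserving T
        ((n : ℝ≥0∞)⁻¹ • ∑ k ∈ Finset.range n, Measure.map (T^[k]) μ)
        ((n : ℝ≥0∞)⁻¹ • ∑ k ∈ Finset.range n, Measure.map (T^[k]) μ) ∧
      Ergodic T ((n : ℝ≥0∞)⁻¹ • ∑ k ∈ Finset.range n, Measure.map (T^[k]) μ) := by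
  have hinv := (hμ.toMeasurePreserving.sum_map_iterate hT).smul_measure (n : ℝ≥0∞)⁻¹
  exact ⟨hinv, hinv, ((hμ.toPreErgodic.of_iterate n).sum_map_iterate hT _).smul_measure _⟩
end
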